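/- Let x : [λ₀,λ₁] → M be a future-directed causal C¹ curve whose t-component has everywhere positive derivative, with x(λ₀) = (t₀,q₀,y₀) and x(λ₁) = (t₁,q₁,y₁), and let q̃ : [t₀,t₁] → ℝ^d be the q-component of x reparametrized by t. Then y₁ − y₀ ≥ I[q̃], with equality if and only if x is lightlike (Q_{x(λ)}(x'(λ)) = 0 for all λ). In particular, among all causal curves from a point m₀ to the fiber {(t₁,q₁)} × ℝ with a given projection q̃, the light lift minimizes the arrival y-coordinate, and the minimal increment of y equals the classical action of the projection. -/

import Mathlib

open Set

/-- The Eisenhart metric in Bargmann form on `M = ℝ × (Fin d → ℝ) × ℝ`: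
`g_x(V,V') = a(t,q)(v,v') − τ(υ'−b v') − τ'(υ−b v) − 2𝒰ττ'`. -/
noncomputable def barG {d : ℕ}
    (a : ℝ → (Fin d → ℝ) → (Fin d → ℝ) → (Fin d → ℝ) → ℝ)
    (b : ℝ → (Fin d → ℝ) → (Fin d → ℝ) → ℝ)
    (𝒰 : ℝ → (Fin d → ℝ) → ℝ)
    (x V V' : ℝ × (Fin d → ℝ) × ℝ) : ℝ :=
  a x.1 x.2.1 V.2.1 V'.2.1 - V.1 * (V'.2.2 - b x.1 x.2.1 V'.2.1)
    - V'.1 * (V.2.2 - b x.1 x.2.1 V.2.1) - 2 * 𝒰 x.1 x.2.1 * V.1 * V'.1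

/-- The classical Lagrangian `L(t,q,q̇) = ½ a(t,q)(q̇,q̇) + b(t,q)(q̇) − 𝒰(t,q)`. -/
noncomputable def classicalLag {d : ℕ}
    (a : ℝ → (Fin d → ℝ) → (Fin d → ℝ) → (Fin d → ℝ) → ℝ)
    (b : ℝ → (Fin d → ℝ) → (Fin d → ℝ) → ℝ)
    (𝒰 : ℝ → (Fin d → ℝ) → ℝ)
    (t : ℝ) (p v : Fin d → ℝ) : ℝ :=
  (1 / 2) * a t p v v + b t p v - 𝒰 t p

/-- A vector `V = (τ,v,υ)` is future-directed causal at `x` if `Q_x(V) ≤ 0` and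
either `τ > 0`, or `τ = 0` and `υ > 0`. -/
def FDCausalB {d : ℕ}
    (a : ℝ → (Fin d → ℝ) → (Fin d → ℝ) → (Fin d → ℝ) → ℝ)
    (b : ℝ → (Fin d → ℝ) → (Fin d → ℝ) → ℝ)
    (𝒰 : ℝ → (Fin d → ℝ) → ℝ)
    (x V : ℝ × (Fin d → ℝ) × ℝ) : Prop :=
  barG a b 𝒰 x V V ≤ 0 ∧ (0 < V.1 ∨ (V.1 = 0 ∧ 0 < V.2.2))

/-- A linear form on `ℝ^d` is determined by its values on the standard basis. -/
theorem linearMap_apply_eq_sum_single {d : ℕ} (f : (Fin d → ℝ) →ₗ[ℝ] ℝ) (u : Fin d → ℝ) :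
    f u = ∑ i, u i * f (Pi.single i 1) := by
  conv_lhs => rw [pi_eq_sum_univ' u, map_sum]
  simp only [map_smul, smul_eq_mul]

/-- A family of bilinear forms with continuous coefficients, evaluated along continuous
curves, is continuous. -/
theorem continuousOn_bilin_curve {d : ℕ}
    {a : ℝ → (Fin d → ℝ) → (Fin d → ℝ) → (Fin d → ℝ) → ℝ}
    (hsymm : ∀ t q v w, a t q v w = a t q w v)
    (halin : ∀ t q w, IsLinearMap ℝ (fun v => a t q v w))
    (hareg : ∀ v w, Continuous (fun p : ℝ × (Fin d → ℝ) => a p.1 p.2 v w))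
    {S : Set ℝ} {q v : ℝ → Fin d → ℝ} (hq : ContinuousOn q S) (hv : ContinuousOn v S) :
    ContinuousOn (fun s => a s (q s) (v s) (v s)) S := by
  have expand (t : ℝ) (p u w : Fin d → ℝ) :
      a t p u w = ∑ i, u i * a t p (Pi.single i 1) w :=
    linearMap_apply_eq_sum_single ((halin t p w).mk' _) u
  have key (s : ℝ) : a s (q s) (v s) (v s) =
      ∑ i, v s i * ∑ j, v s j * a s (q s) (Pi.single j 1) (Pi.single i 1) := by
    rw [expand]
    refine Finset.sum_congr rfl fun i _ => ?_
    rw [hsymm, expand]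
  simp only [key]
  have hcoord (i : Fin d) : ContinuousOn (fun s => v s i) S := continuousOn_pi.1 hv i
  exact continuousOn_finsetSum _ fun i _ => (hcoord i).mul <|
    continuousOn_finsetSum _ fun j _ => (hcoord j).mul <|
      (hareg (Pi.single j 1) (Pi.single i 1)).comp_continuousOn (continuousOn_id.prodMk hq)

/-- A family of linear forms with continuous coefficients, evaluated along continuous
curves, is continuous. -/
theorem continuousOn_lin_curve {d : ℕ} {b : ℝ → (Fin d → ℝ) → (Fin d → ℝ) → ℝ}
    (hblin : ∀ t q, IsLinearMap ℝ (b t q))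
    (hbreg : ∀ v, Continuous (fun p : ℝ × (Fin d → ℝ) => b p.1 p.2 v))
    {S : Set ℝ} {q v : ℝ → Fin d → ℝ} (hq : ContinuousOn q S) (hv : ContinuousOn v S) :
    ContinuousOn (fun s => b s (q s) (v s)) S := by
  have key (s : ℝ) : b s (q s) (v s) = ∑ i, v s i * b s (q s) (Pi.single i 1) :=
    linearMap_apply_eq_sum_single ((hblin s (q s)).mk' _) (v s)
  simp only [key]
  exact continuousOn_finsetSum _ fun i _ => (continuousOn_pi.1 hv i).mul <|
    (hbreg (Pi.single i 1)).comp_continuousOn (continuousOn_id.prodMk hq)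

/-- The Eisenhart quadratic form of `(τ, τ w, υ)` is `2τ(τ L(w) − υ)`. -/
theorem barG_self_eq_classicalLag {d : ℕ}
    {a : ℝ → (Fin d → ℝ) → (Fin d → ℝ) → (Fin d → ℝ) → ℝ}
    {b : ℝ → (Fin d → ℝ) → (Fin d → ℝ) → ℝ} (𝒰 : ℝ → (Fin d → ℝ) → ℝ)
    (hsymm : ∀ t q v w, a t q v w = a t q w v)
    (halin : ∀ t q w, IsLinearMap ℝ (fun v => a t q v w))
    (hblin : ∀ t q, IsLinearMap ℝ (b t q))
    (x V : ℝ × (Fin d → ℝ) × ℝ) (w : Fin d → ℝ) (hV : V.2.1 = V.1 • w) :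
    barG a b 𝒰 x V V = 2 * V.1 * (V.1 * classicalLag a b 𝒰 x.1 x.2.1 w - V.2.2) := by
  have smul_left (u : Fin d → ℝ) : a x.1 x.2.1 (V.1 • w) u = V.1 * a x.1 x.2.1 w u :=
    (halin x.1 x.2.1 u).map_smul V.1 w
  have hb : b x.1 x.2.1 (V.1 • w) = V.1 * b x.1 x.2.1 w := (hblin x.1 x.2.1).map_smul V.1 w
  rw [barG, classicalLag, hV, smul_left, hsymm _ _ w, smul_left, hb]
  ring

/-- A continuous nonnegative function on `[a, b]` has vanishing integral iff it vanishes. -/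
theorem intervalIntegral_eq_zero_iff_of_continuousOn {f : ℝ → ℝ} {a b : ℝ} (hab : a < b)
    (hf : ContinuousOn f (Icc a b)) (hnonneg : ∀ l ∈ Icc a b, 0 ≤ f l) :
    ∫ l in a..b, f l = 0 ↔ ∀ l ∈ Icc a b, f l = 0 := by
  constructor
  · intro h0 l hl
    by_contra hne
    have := intervalIntegral.integral_pos hab hf
      (fun s hs => hnonneg s (Ioc_subset_Icc_self hs)) ⟨l, hl, (hnonneg l hl).lt_of_ne' hne⟩
    exact this.ne' h0
  · intro h
    rw [intervalIntegral.integral_congr (g := fun _ => 0)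
      (fun l hl => h l (uIcc_of_le hab.le ▸ hl)), intervalIntegral.integral_zero]

/-- Along a future-directed causal curve with `t' > 0`, the increment of the
`y`-coordinate dominates the classical action of the projection, with equality
exactly for lightlike curves: the light lift minimizes the arrival `y`-coordinate
among causal curves with a given projection. -/
theorem causal_curve_y_increment_ge_action (d : ℕ) (hd : 1 ≤ d)
    (a : ℝ → (Fin d → ℝ) → (Fin d → ℝ) → (Fin d → ℝ) → ℝ)
    (b : ℝ → (Fin d → ℝ) → (Fin d → ℝ) → ℝ)
    (𝒰 : ℝ → (Fin d → ℝ) → ℝ)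
    (hsymm : ∀ t q v w, a t q v w = a t q w v)
    (halin : ∀ t q w, IsLinearMap ℝ (fun v => a t q v w))
    (hapos : ∀ t q v, v ≠ 0 → 0 < a t q v v)
    (hblin : ∀ t q, IsLinearMap ℝ (b t q))
    (hareg : ∀ v w, ContDiff ℝ 1 (fun p : ℝ × (Fin d → ℝ) => a p.1 p.2 v w))
    (hbreg : ∀ v, ContDiff ℝ 1 (fun p : ℝ × (Fin d → ℝ) => b p.1 p.2 v))
    (hUreg : ContDiff ℝ 1 (fun p : ℝ × (Fin d → ℝ) => 𝒰 p.1 p.2))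
    (lam₀ lam₁ : ℝ) (hlam : lam₀ < lam₁)
    (x x' : ℝ → ℝ × (Fin d → ℝ) × ℝ)
    (hx : ∀ l ∈ Icc lam₀ lam₁, HasDerivWithinAt x (x' l) (Icc lam₀ lam₁) l)
    (hxc : ContinuousOn x' (Icc lam₀ lam₁))
    (hcausal : ∀ l ∈ Icc lam₀ lam₁, FDCausalB a b 𝒰 (x l) (x' l))
    (htpos : ∀ l ∈ Icc lam₀ lam₁, 0 < (x' l).1)
    (t₀ t₁ : ℝ) (q₀ q₁ : Fin d → ℝ) (y₀ y₁ : ℝ) (ht : t₀ < t₁)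
    (hx0 : x lam₀ = (t₀, q₀, y₀)) (hx1 : x lam₁ = (t₁, q₁, y₁))
    (qt qt' : ℝ → Fin d → ℝ)
    (hqt : ∀ t ∈ Icc t₀ t₁, HasDerivWithinAt qt (qt' t) (Icc t₀ t₁) t)
    (hqtc : ContinuousOn qt' (Icc t₀ t₁))
    (hproj : ∀ l ∈ Icc lam₀ lam₁, qt ((x l).1) = (x l).2.1) :
    (∫ s in t₀..t₁, classicalLag a b 𝒰 s (qt s) (qt' s)) ≤ y₁ - y₀ ∧
    (y₁ - y₀ = (∫ s in t₀..t₁, classicalLag a b 𝒰 s (qt s) (qt' s)) ↔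
      ∀ l ∈ Icc lam₀ lam₁, barG a b 𝒰 (x l) (x' l) (x' l) = 0) := by
  set J := Icc lam₀ lam₁
  have huIcc : uIcc lam₀ lam₁ = J := uIcc_of_le hlam.le
  have hxcont : ContinuousOn x J := fun l hl => (hx l hl).continuousWithinAt
  have htd (l) (hl : l ∈ J) : HasDerivWithinAt (fun l => (x l).1) (x' l).1 J l := (hx l hl).fst
  have hqd (l) (hl : l ∈ J) : HasDerivWithinAt (fun l => (x l).2.1) (x' l).2.1 J l :=
    (hx l hl).snd.fst
  have hyd (l) (hl : l ∈ J) : HasDerivWithinAt (fun l => (x l).2.2) (x' l).2.2 J l :=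
    (hx l hl).snd.snd
  have htcont : ContinuousOn (fun l => (x l).1) J := hxcont.fst
  have hycont : ContinuousOn (fun l => (x l).2.2) J := hxcont.snd.snd
  have htcont' : ContinuousOn (fun l => (x' l).1) J := hxc.fst
  have hycont' : ContinuousOn (fun l => (x' l).2.2) J := hxc.snd.snd
  have hmono : MonotoneOn (fun l => (x l).1) J := by
    refine monotoneOn_of_hasDerivWithinAt_nonneg (f' := fun l => (x' l).1)
      (convex_Icc _ _) htcont (fun l hl => ?_) (fun l hl => ?_)
    · exact (htd l (interior_subset hl)).mono interior_subset
    · exact (htpos l (interior_subset hl)).le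
  have hmaps : MapsTo (fun l => (x l).1) J (Icc t₀ t₁) := by
    intro l hl
    have h0 := hmono (left_mem_Icc.2 hlam.le) hl hl.1
    have h1 := hmono hl (right_mem_Icc.2 hlam.le) hl.2
    simp only [hx0, hx1] at h0 h1
    exact ⟨h0, h1⟩
  have hvel (l) (hl : l ∈ J) : (x' l).2.1 = (x' l).1 • qt' (x l).1 := by
    have hcomp : HasDerivWithinAt (fun l => (x l).2.1) ((x' l).1 • qt' (x l).1) J l :=
      ((hqt _ (hmaps hl)).scomp l (htd l hl) hmaps).congr
        (fun m hm => (hproj m hm).symm) (hproj l hl).symm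
    exact (uniqueDiffOn_Icc hlam l hl).eq_deriv _ (hqd l hl) hcomp
  let L : ℝ → ℝ := fun s => classicalLag a b 𝒰 s (qt s) (qt' s)
  have hqtcont : ContinuousOn qt (Icc t₀ t₁) := fun t h => (hqt t h).continuousWithinAt
  have hL : ContinuousOn L (Icc t₀ t₁) :=
    ((continuousOn_const.mul (continuousOn_bilin_curve hsymm halin
      (fun v w => (hareg v w).continuous) hqtcont hqtc)).add
      (continuousOn_lin_curve hblin (fun v => (hbreg v).continuous) hqtcont hqtc)).sub
      (hUreg.continuous.comp_continuousOn (continuousOn_id.prodMk hqtcont))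
  let D : ℝ → ℝ := fun l => (x' l).2.2 - L (x l).1 * (x' l).1
  have hLt : ContinuousOn (fun l => L (x l).1 * (x' l).1) J :=
    (hL.comp htcont hmaps).mul htcont'
  have hD : ContinuousOn D J := hycont'.sub hLt
  have hQ (l) (hl : l ∈ J) : barG a b 𝒰 (x l) (x' l) (x' l) = -(2 * (x' l).1 * D l) := by
    rw [barG_self_eq_classicalLag 𝒰 hsymm halin hblin _ _ _ (hvel l hl), ← hproj l hl]
    simp only [D, L]
    ring
  have hDnonneg (l) (hl : l ∈ J) : 0 ≤ D l := by
    have h := (hcausal l hl).1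
    rw [hQ l hl, neg_nonpos] at h
    exact nonneg_of_mul_nonneg_right h (mul_pos two_pos (htpos l hl))
  have hright {f : ℝ → ℝ} {f' : ℝ} {l : ℝ} (hl : l ∈ Ioo lam₀ lam₁)
      (h : HasDerivWithinAt f f' J l) : HasDerivWithinAt f f' (Ioi l) l :=
    (h.hasDerivAt (Icc_mem_nhds hl.1 hl.2)).hasDerivWithinAt
  have hchange : ∫ l in lam₀..lam₁, L (x l).1 * (x' l).1 = ∫ s in t₀..t₁, L s := by
    have h := intervalIntegral.integral_comp_mul_deriv'' (a := lam₀) (b := lam₁)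
      (f := fun l => (x l).1) (f' := fun l => (x' l).1) (g := L)
      (huIcc ▸ htcont)
      (fun l hl => by
        rw [min_eq_left hlam.le, max_eq_right hlam.le] at hl
        exact hright hl (htd l (Ioo_subset_Icc_self hl)))
      (huIcc ▸ htcont') (hL.mono (huIcc ▸ hmaps.image_subset))
    simpa only [Function.comp_def, hx0, hx1] using h
  have hy : ∫ l in lam₀..lam₁, (x' l).2.2 = y₁ - y₀ := by
    have h := intervalIntegral.integral_eq_sub_of_hasDeriv_right_of_le hlam.le hycont
      (fun l hl => hright hl (hyd l (Ioo_subset_Icc_self hl)))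
      (hycont'.intervalIntegrable_of_Icc hlam.le)
    simpa only [hx0, hx1] using h
  have hint : ∫ l in lam₀..lam₁, D l = y₁ - y₀ - ∫ s in t₀..t₁, L s := by
    rw [← hy, ← hchange]
    exact intervalIntegral.integral_sub (hycont'.intervalIntegrable_of_Icc hlam.le)
      (hLt.intervalIntegrable_of_Icc hlam.le)
  change (∫ s in t₀..t₁, L s) ≤ y₁ - y₀ ∧ (y₁ - y₀ = (∫ s in t₀..t₁, L s) ↔ _)
  constructor
  · exact sub_nonneg.1 (hint ▸ intervalIntegral.integral_nonneg hlam.le hDnonneg)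
  · rw [← sub_eq_zero, ← hint, intervalIntegral_eq_zero_iff_of_continuousOn hlam hD hDnonneg]
    refine forall₂_congr fun l hl => ?_
    rw [hQ l hl, neg_eq_zero, mul_eq_zero, or_iff_right (mul_pos two_pos (htpos l hl)).ne']
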